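/- Fix n, m ∈ ℕ. For a smooth function u on (0,∞) × ℝⁿ define ‖u‖²_{H₀ᵐ} = Σ_{i + |α| ≤ m} ∫ |(τ∂_τ)ⁱ (τ∂_x)^α u(τ,x)|² τ^(−(n+1)) dx dτ. Then there exists C > 1 such that for every smooth u supported in {(τ,x) : τ ≤ 1, |x| ≤ 1}: C^(−1) ‖u‖²_{H₀ᵐ} ≤ Σ_{k=0}^∞ Σ_{α ∈ ℤⁿ, |α|_∞ ≤ 2ᵏ} ‖u_{k,α}‖²_{Hᵐ([−1/2,1/2]^{n+1})} ≤ C ‖u‖²_{H₀ᵐ}, where u_{k,α}(T,X) := u(2^{−k}(1+T), 2^{−k}(α+X)) for (T,X) ∈ [−1/2,1/2] × [−1/2,1/2]ⁿ, and ‖w‖²_{Hᵐ(Q)} = Σ_{|β| ≤ m} ∫_Q |∂^β w|² is the standard Sobolev norm on the cube Q = [−1/2,1/2]^{n+1}. -/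

import Mathlib

open MeasureTheory
open scoped ENNReal

/-- The 0-vector field `τ ∂_τ`. -/
noncomputable def tauDtau (n : ℕ) (u : ℝ × (Fin n → ℝ) → ℝ) :
    ℝ × (Fin n → ℝ) → ℝ :=
  fun p => p.1 * fderiv ℝ u p (1, 0)

/-- The coordinate vector field `∂_T` in the first variable. -/
noncomputable def DT (n : ℕ) (u : ℝ × (Fin n → ℝ) → ℝ) : ℝ × (Fin n → ℝ) → ℝ :=
  fun p => fderiv ℝ u p (1, 0)

/-- The coordinate vector field `∂_{x_j}`. -/
noncomputable def Dxj (n : ℕ) (j : Fin n) (u : ℝ × (Fin n → ℝ) → ℝ) :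
    ℝ × (Fin n → ℝ) → ℝ :=
  fun p => fderiv ℝ u p (0, Pi.single j 1)

/-- The iterated spatial derivative `∂_x^α` for a multi-index `α ∈ ℕⁿ`. -/
noncomputable def DxAlpha (n : ℕ) (α : Fin n → ℕ) :
    (ℝ × (Fin n → ℝ) → ℝ) → (ℝ × (Fin n → ℝ) → ℝ) :=
  (List.finRange n).foldr (fun j F => (Dxj n j)^[α j] ∘ F) id

/-- The 0-derivative `(τ∂_τ)ⁱ (τ∂_x)^α u`, where `(τ∂_x)^α = τ^{|α|} ∂_x^α`. -/
noncomputable def zeroDeriv (n : ℕ) (i : ℕ) (α : Fin n → ℕ)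
    (u : ℝ × (Fin n → ℝ) → ℝ) : ℝ × (Fin n → ℝ) → ℝ :=
  (tauDtau n)^[i] fun p => p.1 ^ (∑ j, α j) * DxAlpha n α u p

/-- The flat iterated derivative `∂_T^i ∂_X^α w`. -/
noncomputable def flatDeriv (n : ℕ) (i : ℕ) (α : Fin n → ℕ)
    (w : ℝ × (Fin n → ℝ) → ℝ) : ℝ × (Fin n → ℝ) → ℝ :=
  (DT n)^[i] (DxAlpha n α w)

/-- The finite set of pairs `(i, α)` with `i + |α| ≤ m`. -/
def zeroIndex (n m : ℕ) : Finset (ℕ × (Fin n → ℕ)) :=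
  (Finset.range (m + 1) ×ˢ Fintype.piFinset fun _ => Finset.range (m + 1)).filter
    fun q => q.1 + ∑ j, q.2 j ≤ m

/-- The squared 0-Sobolev norm of order `m` on `(0,∞)_τ × ℝⁿ_x`. -/
noncomputable def zeroSobNormSq (n m : ℕ) (u : ℝ × (Fin n → ℝ) → ℝ) : ℝ≥0∞ :=
  ∑ q ∈ zeroIndex n m,
    ∫⁻ p in Set.Ioi (0 : ℝ) ×ˢ (Set.univ : Set (Fin n → ℝ)),
      ENNReal.ofReal ((zeroDeriv n q.1 q.2 u p) ^ 2 * p.1 ^ (-(n + 1 : ℤ)))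

/-- The cube `[-1/2, 1/2]^{n+1}`. -/
def unitCube (n : ℕ) : Set (ℝ × (Fin n → ℝ)) :=
  Set.Icc (-(1 / 2) : ℝ) (1 / 2) ×ˢ
    Set.pi Set.univ fun _ : Fin n => Set.Icc (-(1 / 2) : ℝ) (1 / 2)

/-- The squared standard Sobolev norm of order `m` on the cube `[-1/2, 1/2]^{n+1}`:
`‖w‖²_{Hᵐ(Q)} = Σ_{|β| ≤ m} ∫_Q |∂^β w|²`. -/
noncomputable def cubeSobNormSq (n m : ℕ) (w : ℝ × (Fin n → ℝ) → ℝ) : ℝ≥0∞ :=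
  ∑ q ∈ zeroIndex n m,
    ∫⁻ p in unitCube n, ENNReal.ofReal ((flatDeriv n q.1 q.2 w p) ^ 2)

/-- The dyadic rescaling `u_{k,α}(T, X) = u(2^{-k}(1+T), 2^{-k}(α+X))`. -/
noncomputable def dyadicPiece (n : ℕ) (k : ℕ) (α : Fin n → ℤ)
    (u : ℝ × (Fin n → ℝ) → ℝ) : ℝ × (Fin n → ℝ) → ℝ :=
  fun p => u ((2 : ℝ) ^ (-(k : ℤ)) * (1 + p.1),
    fun j => (2 : ℝ) ^ (-(k : ℤ)) * ((α j : ℝ) + p.2 j))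

/-- The dyadic sum `Σ_{k=0}^∞ Σ_{α ∈ ℤⁿ, |α|_∞ ≤ 2ᵏ} ‖u_{k,α}‖²_{Hᵐ(Q)}`. -/
noncomputable def dyadicNormSq (n m : ℕ) (u : ℝ × (Fin n → ℝ) → ℝ) : ℝ≥0∞ :=
  ∑' k : ℕ, ∑' α : Fin n → ℤ,
    if ∀ j, |α j| ≤ 2 ^ k then cubeSobNormSq n m (dyadicPiece n k α u) else 0

/-- The open upper half space `(0,∞) × ℝⁿ`. -/
def upperHalf (n : ℕ) : Set (ℝ × (Fin n → ℝ)) := Set.Ioi (0 : ℝ) ×ˢ Set.univ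

theorem isOpen_upperHalf (n : ℕ) : IsOpen (upperHalf n) := isOpen_Ioi.prod isOpen_univ

theorem mem_upperHalf {n : ℕ} {p : ℝ × (Fin n → ℝ)} : p ∈ upperHalf n ↔ 0 < p.1 := by
  simp [upperHalf]

/-- A graded relation propagated by each coordinate vector field is propagated by
`flatDeriv`. -/
theorem flatDeriv_rel {n : ℕ} {R : ℕ → (ℝ × (Fin n → ℝ) → ℝ) → (ℝ × (Fin n → ℝ) → ℝ) → Prop}
    (hT : ∀ k f g, R k f g → R (k + 1) (DT n f) (DT n g))
    (hX : ∀ j k f g, R k f g → R (k + 1) (Dxj n j f) (Dxj n j g))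
    {f g : ℝ × (Fin n → ℝ) → ℝ} (h : R 0 f g) (i : ℕ) (α : Fin n → ℕ) :
    R (i + ∑ j, α j) (flatDeriv n i α f) (flatDeriv n i α g) := by
  have iter : ∀ (D : (ℝ × (Fin n → ℝ) → ℝ) → ℝ × (Fin n → ℝ) → ℝ),
      (∀ k f g, R k f g → R (k + 1) (D f) (D g)) → ∀ a k f g, R k f g →
      R (a + k) (D^[a] f) (D^[a] g) := by
    intro D hD a
    induction a with
    | zero => intro k f g h; simpa using h
    | succ a ih =>
      intro k f g h
      rw [Function.iterate_succ_apply', Function.iterate_succ_apply', Nat.add_right_comm]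
      exact hD _ _ _ (ih k f g h)
  refine iter _ hT i _ _ _ ?_
  rw [Fin.sum_univ_def, DxAlpha]
  induction List.finRange n with
  | nil => simpa using h
  | cons j l ih =>
    simp only [List.map_cons, List.sum_cons, List.foldr_cons, Function.comp_apply]
    exact iter _ (hX j) _ _ _ _ ih

theorem contDiffOn_fderiv_apply {n : ℕ} {f : ℝ × (Fin n → ℝ) → ℝ}
    (h : ContDiffOn ℝ (⊤ : ℕ∞) f (upperHalf n)) (v : ℝ × (Fin n → ℝ)) :
    ContDiffOn ℝ (⊤ : ℕ∞) (fun p => fderiv ℝ f p v) (upperHalf n) :=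
  ((contDiffOn_infty_iff_fderiv_of_isOpen (isOpen_upperHalf n)).1 h).2.clm_apply contDiffOn_const

theorem contDiffOn_flatDeriv {n : ℕ} {f : ℝ × (Fin n → ℝ) → ℝ}
    (h : ContDiffOn ℝ (⊤ : ℕ∞) f (upperHalf n)) (i : ℕ) (α : Fin n → ℕ) :
    ContDiffOn ℝ (⊤ : ℕ∞) (flatDeriv n i α f) (upperHalf n) :=
  flatDeriv_rel (R := fun _ f _ => ContDiffOn ℝ (⊤ : ℕ∞) f (upperHalf n)) (g := f)
    (fun _ _ _ h => contDiffOn_fderiv_apply h _) (fun _ _ _ _ h => contDiffOn_fderiv_apply h _)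
    h i α

theorem fderiv_eq_zero_of_eqOn_zero {E : Type*} [NormedAddCommGroup E] [NormedSpace ℝ E]
    {f : E → ℝ} {V : Set E} (hV : IsOpen V) (h : Set.EqOn f 0 V) {p : E} (hp : p ∈ V) :
    fderiv ℝ f p = 0 := by
  rw [(h.eventuallyEq_of_mem (hV.mem_nhds hp)).fderiv_eq]
  simp

theorem flatDeriv_eqOn_zero {n : ℕ} {f : ℝ × (Fin n → ℝ) → ℝ} {V : Set (ℝ × (Fin n → ℝ))}
    (hV : IsOpen V) (h : Set.EqOn f 0 V) (i : ℕ) (α : Fin n → ℕ) :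
    Set.EqOn (flatDeriv n i α f) 0 V :=
  flatDeriv_rel (R := fun _ f _ => Set.EqOn f 0 V) (g := f)
    (fun _ _ _ h p hp => by simp [DT, fderiv_eq_zero_of_eqOn_zero hV h hp])
    (fun _ _ _ _ h p hp => by simp [Dxj, fderiv_eq_zero_of_eqOn_zero hV h hp])
    h i α

theorem fderiv_mul_comp_smul_add {E : Type*} [NormedAddCommGroup E] [NormedSpace ℝ E]
    (a c : ℝ) (b : E) (f : E → ℝ) (p v : E) :
    fderiv ℝ (fun p => a * f (c • p + b)) p v = a * c * fderiv ℝ f (c • p + b) v := by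
  have h : (fun p => a * f (c • p + b)) = a • fun p => f (c • p + b) := rfl
  rw [h, fderiv_const_smul_field, Pi.smul_apply,
    fderiv_comp_smul (f := fun x => f (x + b)), fderiv_comp_add_right]
  simp [mul_assoc]

theorem flatDeriv_comp_smul_add {n : ℕ} (c : ℝ) (b : ℝ × (Fin n → ℝ))
    (f : ℝ × (Fin n → ℝ) → ℝ) (i : ℕ) (α : Fin n → ℕ) :
    flatDeriv n i α (fun p => f (c • p + b)) =
      fun p => c ^ (i + ∑ j, α j) * flatDeriv n i α f (c • p + b) := by
  refine flatDeriv_rel (R := fun k f g => f = fun p => c ^ k * g (c • p + b)) ?_ ?_ ?_ i α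
  · rintro k f g rfl
    funext p
    rw [DT, fderiv_mul_comp_smul_add, pow_succ, DT]
  · rintro j k f g rfl
    funext p
    rw [Dxj, fderiv_mul_comp_smul_add, pow_succ, Dxj]
  · simp

theorem dyadicPiece_eq (n k : ℕ) (α : Fin n → ℤ) (u : ℝ × (Fin n → ℝ) → ℝ) :
    dyadicPiece n k α u = fun p => u ((2 : ℝ) ^ (-(k : ℤ)) • p +
      (2 : ℝ) ^ (-(k : ℤ)) • ((1 : ℝ), fun j => (α j : ℝ))) := by
  funext p
  rw [dyadicPiece]
  congr 1
  ext <;> simp <;> ring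

/-- The weighted flat derivative `τ^{i+|α|} ∂_τ^i ∂_x^α u`. -/
noncomputable def weightedDeriv (n i : ℕ) (α : Fin n → ℕ) (u : ℝ × (Fin n → ℝ) → ℝ) :
    ℝ × (Fin n → ℝ) → ℝ :=
  fun p => p.1 ^ (i + ∑ j, α j) * flatDeriv n i α u p

theorem contDiffOn_weightedDeriv {n : ℕ} {u : ℝ × (Fin n → ℝ) → ℝ}
    (h : ContDiffOn ℝ (⊤ : ℕ∞) u (upperHalf n)) (i : ℕ) (α : Fin n → ℕ) :
    ContDiffOn ℝ (⊤ : ℕ∞) (weightedDeriv n i α u) (upperHalf n) :=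
  (contDiff_fst.contDiffOn.pow _).mul (contDiffOn_flatDeriv h i α)

theorem zeroDeriv_zero (n : ℕ) (α : Fin n → ℕ) (u : ℝ × (Fin n → ℝ) → ℝ) :
    zeroDeriv n 0 α u = weightedDeriv n 0 α u := by
  funext p
  simp [zeroDeriv, weightedDeriv, flatDeriv]

theorem zeroDeriv_succ (n i : ℕ) (α : Fin n → ℕ) (u : ℝ × (Fin n → ℝ) → ℝ) :
    zeroDeriv n (i + 1) α u = tauDtau n (zeroDeriv n i α u) := by
  rw [zeroDeriv, Function.iterate_succ_apply', zeroDeriv]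

theorem contDiffOn_zeroDeriv {n : ℕ} {u : ℝ × (Fin n → ℝ) → ℝ}
    (h : ContDiffOn ℝ (⊤ : ℕ∞) u (upperHalf n)) (i : ℕ) (α : Fin n → ℕ) :
    ContDiffOn ℝ (⊤ : ℕ∞) (zeroDeriv n i α u) (upperHalf n) := by
  induction i with
  | zero => rw [zeroDeriv_zero]; exact contDiffOn_weightedDeriv h 0 α
  | succ i ih =>
    rw [zeroDeriv_succ]
    exact contDiff_fst.contDiffOn.mul (contDiffOn_fderiv_apply ih _)

theorem differentiableAt_of_contDiffOn_upperHalf {n : ℕ} {f : ℝ × (Fin n → ℝ) → ℝ}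
    (h : ContDiffOn ℝ (⊤ : ℕ∞) f (upperHalf n)) {p : ℝ × (Fin n → ℝ)} (hp : p ∈ upperHalf n) :
    DifferentiableAt ℝ f p :=
  (h.contDiffAt ((isOpen_upperHalf n).mem_nhds hp)).differentiableAt (by simp)

theorem tauDtau_weightedDeriv {n : ℕ} {u : ℝ × (Fin n → ℝ) → ℝ}
    (h : ContDiffOn ℝ (⊤ : ℕ∞) u (upperHalf n)) (i : ℕ) (α : Fin n → ℕ)
    {p : ℝ × (Fin n → ℝ)} (hp : p ∈ upperHalf n) :
    tauDtau n (weightedDeriv n i α u) p =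
      ((i + ∑ j, α j : ℕ) : ℝ) * weightedDeriv n i α u p + weightedDeriv n (i + 1) α u p := by
  have hf := (differentiableAt_of_contDiffOn_upperHalf (contDiffOn_flatDeriv h i α) hp).hasFDerivAt
  have hpow := (hasFDerivAt_fst (𝕜 := ℝ) (p := p)).pow (i + ∑ j, α j)
  have hD : flatDeriv n (i + 1) α u p = fderiv ℝ (flatDeriv n i α u) p (1, 0) := by
    rw [flatDeriv, Function.iterate_succ_apply', ← flatDeriv, DT]
  rw [tauDtau, show weightedDeriv n i α u =
    (fun p : ℝ × (Fin n → ℝ) => p.1 ^ (i + ∑ j, α j)) * flatDeriv n i α u from rfl,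
    (hpow.mul hf).fderiv]
  simp only [weightedDeriv, hD, Pi.mul_apply]
  rcases Nat.eq_zero_or_pos (i + ∑ j, α j) with h0 | h0
  · have : i + 1 + ∑ j, α j = 1 := by omega
    simp [h0, this]
  · obtain ⟨d, hd⟩ : ∃ d, i + ∑ j, α j = d + 1 := ⟨_, (Nat.sub_add_cancel h0).symm⟩
    have : i + 1 + ∑ j, α j = d + 2 := by omega
    rw [hd, this]
    simp
    ring

/-- Two sequences generated from the same function by first-order recursions in `τ∂_τ` are
triangular combinations of one another, with universal coefficients. -/
theorem exists_coeff_of_tauDtau_rec (n : ℕ) (a e : ℕ → ℝ) (i : ℕ) :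
    ∃ c : ℕ → ℝ, ∀ P Q : ℕ → ℝ × (Fin n → ℝ) → ℝ,
      (∀ j, ContDiffOn ℝ (⊤ : ℕ∞) (P j) (upperHalf n)) → Q 0 = P 0 →
      (∀ j, ∀ p ∈ upperHalf n, tauDtau n (P j) p = a j * P j p + P (j + 1) p) →
      (∀ j, ∀ p ∈ upperHalf n, Q (j + 1) p = tauDtau n (Q j) p + e j * Q j p) →
      ∀ p ∈ upperHalf n, Q i p = ∑ j ∈ Finset.range (i + 1), c j * P j p := by
  induction i with
  | zero => exact ⟨fun _ => 1, fun P Q _ h0 _ _ p _ => by simp [h0]⟩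
  | succ i ih =>
    obtain ⟨c, hc⟩ := ih
    refine ⟨fun j => (if j ≤ i then (a j + e i) * c j else 0) +
      (if j = 0 then 0 else c (j - 1)), fun P Q hP h0 hPr hQr p hp => ?_⟩
    have hQ := hc P Q hP h0 hPr hQr
    have hd : fderiv ℝ (Q i) p = ∑ j ∈ Finset.range (i + 1), c j • fderiv ℝ (P j) p := by
      rw [(Set.EqOn.eventuallyEq_of_mem (fun q hq => hQ q hq)
        ((isOpen_upperHalf n).mem_nhds hp)).fderiv_eq]
      refine (HasFDerivAt.fun_sum fun j _ => ?_).fderiv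
      exact (differentiableAt_of_contDiffOn_upperHalf (hP j) hp).hasFDerivAt.const_mul (c j)
    have hL : tauDtau n (Q i) p =
        ∑ j ∈ Finset.range (i + 1), c j * (a j * P j p + P (j + 1) p) := by
      rw [tauDtau, hd, sum_apply, Finset.mul_sum]
      refine Finset.sum_congr rfl fun j _ => ?_
      rw [← hPr j p hp, tauDtau]
      simp
      ring
    rw [hQr i p hp, hL, hQ p hp]
    simp only [add_mul, Finset.sum_add_distrib, mul_add]
    rw [Finset.sum_range_succ (n := i + 1), Finset.sum_range_succ' (n := i + 1)]
    simp only [Finset.mul_sum]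
    simp only [Nat.add_sub_cancel, Nat.succ_ne_zero, if_false, if_true, zero_mul, add_zero,
      Nat.not_succ_le_self]
    rw [add_right_comm, ← Finset.sum_add_distrib]
    congr 1
    refine Finset.sum_congr rfl fun j hj => ?_
    rw [if_pos (Nat.lt_succ_iff.1 (Finset.mem_range.1 hj))]
    ring

theorem mem_zeroIndex {n m : ℕ} {q : ℕ × (Fin n → ℕ)} :
    q ∈ zeroIndex n m ↔ q.1 + ∑ j, q.2 j ≤ m := by
  simp only [zeroIndex, Finset.mem_filter, Finset.mem_product, Finset.mem_range,
    Fintype.mem_piFinset, and_iff_right_iff_imp]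
  intro h
  refine ⟨by omega, fun j => ?_⟩
  have := Finset.single_le_sum (f := q.2) (fun _ _ => Nat.zero_le _) (Finset.mem_univ j)
  omega

/-- Triangular relations between two families give a bound of square sums. -/
theorem sum_zeroIndex_sq_le {n m : ℕ} {c : ℕ × (Fin n → ℕ) → ℕ → ℝ}
    {x y : ℕ → (Fin n → ℕ) → ℝ}
    (h : ∀ q, x q.1 q.2 = ∑ j ∈ Finset.range (q.1 + 1), c q j * y j q.2) :
    ∑ q ∈ zeroIndex n m, x q.1 q.2 ^ 2 ≤
      (∑ q ∈ zeroIndex n m, ∑ j ∈ Finset.range (q.1 + 1), c q j ^ 2) *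
        ∑ q ∈ zeroIndex n m, y q.1 q.2 ^ 2 := by
  rw [Finset.sum_mul]
  refine Finset.sum_le_sum fun q hq => ?_
  rw [h q]
  refine (Finset.sum_mul_sq_le_sq_mul_sq _ _ _).trans ?_
  refine mul_le_mul_of_nonneg_left ?_ (Finset.sum_nonneg fun _ _ => sq_nonneg _)
  rw [← Finset.sum_image (s := Finset.range (q.1 + 1)) (g := fun j => (j, q.2))
    (f := fun q : ℕ × (Fin n → ℕ) => y q.1 q.2 ^ 2) (by intro a _ b _ h; simpa using h)]
  refine Finset.sum_le_sum_of_subset_of_nonneg ?_ fun _ _ _ => sq_nonneg _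
  intro r hr
  obtain ⟨j, hj, rfl⟩ := Finset.mem_image.1 hr
  have := Finset.mem_range.1 hj
  have := mem_zeroIndex.1 hq
  exact mem_zeroIndex.2 (by simp only; omega)

/-- Pointwise comparability of the 0-derivatives and the weighted flat derivatives. -/
theorem exists_zeroDeriv_weightedDeriv_bound (n m : ℕ) :
    ∃ K : ℝ, 0 ≤ K ∧ ∀ u : ℝ × (Fin n → ℝ) → ℝ,
      ContDiffOn ℝ (⊤ : ℕ∞) u (upperHalf n) → ∀ p ∈ upperHalf n,
        ∑ q ∈ zeroIndex n m, zeroDeriv n q.1 q.2 u p ^ 2 ≤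
            K * ∑ q ∈ zeroIndex n m, weightedDeriv n q.1 q.2 u p ^ 2 ∧
          ∑ q ∈ zeroIndex n m, weightedDeriv n q.1 q.2 u p ^ 2 ≤
            K * ∑ q ∈ zeroIndex n m, zeroDeriv n q.1 q.2 u p ^ 2 := by
  choose c hc using fun q : ℕ × (Fin n → ℕ) => exists_coeff_of_tauDtau_rec n
    (fun j => ((j + ∑ l, q.2 l : ℕ) : ℝ)) 0 q.1
  choose d hd using fun q : ℕ × (Fin n → ℕ) => exists_coeff_of_tauDtau_rec n
    0 (fun j => -((j + ∑ l, q.2 l : ℕ) : ℝ)) q.1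
  have hnonneg : ∀ c : ℕ × (Fin n → ℕ) → ℕ → ℝ,
      0 ≤ ∑ q ∈ zeroIndex n m, ∑ j ∈ Finset.range (q.1 + 1), c q j ^ 2 := fun c =>
    Finset.sum_nonneg fun _ _ => Finset.sum_nonneg fun _ _ => sq_nonneg _
  refine ⟨(∑ q ∈ zeroIndex n m, ∑ j ∈ Finset.range (q.1 + 1), c q j ^ 2) +
    ∑ q ∈ zeroIndex n m, ∑ j ∈ Finset.range (q.1 + 1), d q j ^ 2,
    add_nonneg (hnonneg c) (hnonneg d), fun u hu p hp => ⟨?_, ?_⟩⟩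
  · refine (sum_zeroIndex_sq_le (c := c) (x := fun i α => zeroDeriv n i α u p)
      (y := fun i α => weightedDeriv n i α u p) fun q => ?_).trans ?_
    · refine hc q (fun i => weightedDeriv n i q.2 u) (fun i => zeroDeriv n i q.2 u)
        (fun j => contDiffOn_weightedDeriv hu j q.2) (zeroDeriv_zero n q.2 u)
        (fun j p hp => tauDtau_weightedDeriv hu j q.2 hp)
        (fun j p _ => by simp [zeroDeriv_succ]) p hp
    · exact mul_le_mul_of_nonneg_right (le_add_of_nonneg_right (hnonneg d))
        (Finset.sum_nonneg fun _ _ => sq_nonneg _)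
  · refine (sum_zeroIndex_sq_le (c := d) (x := fun i α => weightedDeriv n i α u p)
      (y := fun i α => zeroDeriv n i α u p) fun q => ?_).trans ?_
    · refine hd q (fun i => zeroDeriv n i q.2 u) (fun i => weightedDeriv n i q.2 u)
        (fun j => contDiffOn_zeroDeriv hu j q.2) (zeroDeriv_zero n q.2 u).symm
        (fun j p _ => by simp [zeroDeriv_succ])
        (fun j p hp => by simp only [tauDtau_weightedDeriv hu j q.2 hp]; ring) p hp
    · exact mul_le_mul_of_nonneg_right (le_add_of_nonneg_left (hnonneg c))
        (Finset.sum_nonneg fun _ _ => sq_nonneg _)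

/-- The image of the unit cube under `(T, X) ↦ (2^{-k}(1+T), 2^{-k}(α+X))`. -/
def dyadicBox (n k : ℕ) (α : Fin n → ℤ) : Set (ℝ × (Fin n → ℝ)) :=
  {p | |2 ^ k * p.1 - 1| ≤ 1 / 2 ∧ ∀ j, |2 ^ k * p.2 j - α j| ≤ 1 / 2}

theorem measurableSet_dyadicBox (n k : ℕ) (α : Fin n → ℤ) : MeasurableSet (dyadicBox n k α) := by
  have h : dyadicBox n k α = {p : ℝ × (Fin n → ℝ) | |2 ^ k * p.1 - 1| ≤ 1 / 2} ∩
      ⋂ j, {p : ℝ × (Fin n → ℝ) | |2 ^ k * p.2 j - (α j : ℝ)| ≤ 1 / 2} := by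
    ext p
    simp [dyadicBox]
  rw [h]
  refine IsClosed.measurableSet (IsClosed.inter (isClosed_le (by fun_prop) continuous_const)
    (isClosed_iInter fun j => isClosed_le (by fun_prop) continuous_const))

theorem fst_bounds_of_mem_dyadicBox {n k : ℕ} {α : Fin n → ℤ} {p : ℝ × (Fin n → ℝ)}
    (hp : p ∈ dyadicBox n k α) : 1 ≤ 2 * (2 ^ k * p.1) ∧ 2 ^ k * p.1 ≤ 2 := by
  have := abs_le.1 hp.1
  constructor <;> linarith

theorem dyadicBox_subset_upperHalf (n k : ℕ) (α : Fin n → ℤ) :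
    dyadicBox n k α ⊆ upperHalf n := by
  intro p hp
  have := (fst_bounds_of_mem_dyadicBox hp).1
  rw [mem_upperHalf]
  by_contra! h
  have := mul_nonpos_of_nonneg_of_nonpos (pow_nonneg (zero_le_two (α := ℝ)) k) h
  linarith

theorem image_unitCube (n k : ℕ) (α : Fin n → ℤ) :
    (fun p : ℝ × (Fin n → ℝ) => (2 : ℝ) ^ (-(k : ℤ)) • p +
      (2 : ℝ) ^ (-(k : ℤ)) • ((1 : ℝ), fun j => (α j : ℝ))) '' unitCube n = dyadicBox n k α := by
  have h2 : (2 : ℝ) ^ k ≠ 0 := by positivity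
  ext p
  simp only [Set.mem_image, unitCube, Set.mem_prod, Set.mem_pi, Set.mem_univ, true_implies,
    Set.mem_Icc, dyadicBox, Set.mem_ofPred_eq, ← abs_le, zpow_neg, zpow_natCast]
  constructor
  · rintro ⟨q, ⟨h1, h3⟩, rfl⟩
    refine ⟨?_, fun j => ?_⟩
    · simpa [mul_add, h2] using h1
    · simpa [mul_add, h2] using h3 j
  · rintro ⟨h1, h3⟩
    refine ⟨(2 ^ k * p.1 - 1, fun j => 2 ^ k * p.2 j - α j), ⟨h1, h3⟩, ?_⟩
    ext <;> simp <;> field_simp <;> ring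

theorem measurableSet_unitCube (n : ℕ) : MeasurableSet (unitCube n) :=
  measurableSet_Icc.prod (MeasurableSet.univ_pi fun _ => measurableSet_Icc)

theorem lintegral_dyadicBox (n k : ℕ) (α : Fin n → ℤ) (g : ℝ × (Fin n → ℝ) → ℝ≥0∞) :
    ∫⁻ p in unitCube n, g ((2 : ℝ) ^ (-(k : ℤ)) • p +
      (2 : ℝ) ^ (-(k : ℤ)) • ((1 : ℝ), fun j => (α j : ℝ))) =
      ENNReal.ofReal ((2 ^ k) ^ (n + 1)) * ∫⁻ p in dyadicBox n k α, g p := by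
  have h2 : (0 : ℝ) < 2 ^ (-(k : ℤ)) := by positivity
  have : (volume : Measure (ℝ × (Fin n → ℝ))).IsAddHaarMeasure := by
    rw [Measure.volume_eq_prod]
    infer_instance
  have hφ : ∀ p ∈ unitCube n, HasFDerivWithinAt (fun p : ℝ × (Fin n → ℝ) =>
      (2 : ℝ) ^ (-(k : ℤ)) • p + (2 : ℝ) ^ (-(k : ℤ)) • ((1 : ℝ), fun j => (α j : ℝ)))
      ((2 : ℝ) ^ (-(k : ℤ)) • ContinuousLinearMap.id ℝ (ℝ × (Fin n → ℝ))) (unitCube n) p :=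
    fun p _ => (((hasFDerivWithinAt_id p _).fun_const_smul _).add_const _)
  rw [← image_unitCube, lintegral_image_eq_lintegral_abs_det_fderiv_mul volume
    (measurableSet_unitCube n) hφ]
  · have hdet : ((2 : ℝ) ^ (-(k : ℤ)) • ContinuousLinearMap.id ℝ (ℝ × (Fin n → ℝ))).det =
        ((2 : ℝ) ^ (-(k : ℤ))) ^ (n + 1) := by
      simp [ContinuousLinearMap.det, add_comm]
    rw [hdet, abs_of_pos (by positivity), lintegral_const_mul' _ _ ENNReal.ofReal_ne_top,
      ← mul_assoc, ← ENNReal.ofReal_mul (by positivity), ← mul_pow]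
    simp
  · intro p _ q _ h
    exact smul_right_injective _ h2.ne' (add_right_cancel h)

/-- The density of the weighted square sum with respect to `dτ dx`. -/
noncomputable def weightedDensity (n m : ℕ) (u : ℝ × (Fin n → ℝ) → ℝ) (p : ℝ × (Fin n → ℝ)) :
    ℝ≥0∞ :=
  ENNReal.ofReal ((∑ q ∈ zeroIndex n m, weightedDeriv n q.1 q.2 u p ^ 2) *
    p.1 ^ (-(n + 1 : ℤ)))

theorem zpow_neg_pos_of_mem_upperHalf {n : ℕ} {p : ℝ × (Fin n → ℝ)} (hp : p ∈ upperHalf n) :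
    0 < p.1 ^ (-(n + 1 : ℤ)) :=
  zpow_pos (mem_upperHalf.1 hp) _

theorem aemeasurable_ofReal_of_continuousOn {n : ℕ} {f : ℝ × (Fin n → ℝ) → ℝ}
    {s : Set (ℝ × (Fin n → ℝ))} (hf : ContinuousOn f s) (hs : MeasurableSet s) :
    AEMeasurable (fun p => ENNReal.ofReal (f p)) (volume.restrict s) :=
  (hf.aemeasurable hs).ennreal_ofReal

theorem continuousOn_zpow_neg (n : ℕ) :
    ContinuousOn (fun p : ℝ × (Fin n → ℝ) => p.1 ^ (-(n + 1 : ℤ))) (upperHalf n) :=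
  continuousOn_fst.zpow₀ _ fun _ hp => Or.inl (mem_upperHalf.1 hp).ne'

theorem aemeasurable_weightedDensity {n m : ℕ} {u : ℝ × (Fin n → ℝ) → ℝ}
    (h : ContDiffOn ℝ (⊤ : ℕ∞) u (upperHalf n)) :
    AEMeasurable (weightedDensity n m u) (volume.restrict (upperHalf n)) :=
  aemeasurable_ofReal_of_continuousOn
    ((continuousOn_finsetSum _ fun q _ =>
      (contDiffOn_weightedDeriv h q.1 q.2).continuousOn.pow 2).mul (continuousOn_zpow_neg n))
    (isOpen_upperHalf n).measurableSet

theorem zeroSobNormSq_eq_lintegral {n m : ℕ} {u : ℝ × (Fin n → ℝ) → ℝ}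
    (h : ContDiffOn ℝ (⊤ : ℕ∞) u (upperHalf n)) :
    zeroSobNormSq n m u = ∫⁻ p in upperHalf n,
      ENNReal.ofReal ((∑ q ∈ zeroIndex n m, zeroDeriv n q.1 q.2 u p ^ 2) *
        p.1 ^ (-(n + 1 : ℤ))) := by
  rw [zeroSobNormSq, ← upperHalf, ← lintegral_finsetSum']
  · refine setLIntegral_congr_fun (isOpen_upperHalf n).measurableSet fun p hp => ?_
    simp only [Finset.sum_mul]
    rw [ENNReal.ofReal_sum_of_nonneg]
    exact fun q _ => mul_nonneg (sq_nonneg _) (zpow_neg_pos_of_mem_upperHalf hp).le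
  · intro q _
    exact aemeasurable_ofReal_of_continuousOn
      (((contDiffOn_zeroDeriv h q.1 q.2).continuousOn.pow 2).mul (continuousOn_zpow_neg n))
      (isOpen_upperHalf n).measurableSet

theorem exists_zeroSobNormSq_bound (n m : ℕ) :
    ∃ K : ℝ, 0 ≤ K ∧ ∀ u : ℝ × (Fin n → ℝ) → ℝ,
      ContDiffOn ℝ (⊤ : ℕ∞) u (upperHalf n) →
        zeroSobNormSq n m u ≤
          ENNReal.ofReal K * ∫⁻ p in upperHalf n, weightedDensity n m u p ∧
        ∫⁻ p in upperHalf n, weightedDensity n m u p ≤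
          ENNReal.ofReal K * zeroSobNormSq n m u := by
  obtain ⟨K, hK, hb⟩ := exists_zeroDeriv_weightedDeriv_bound n m
  refine ⟨K, hK, fun u hu => ?_⟩
  rw [zeroSobNormSq_eq_lintegral hu, ← lintegral_const_mul' _ _ ENNReal.ofReal_ne_top,
    ← lintegral_const_mul' _ _ ENNReal.ofReal_ne_top]
  constructor <;>
  · refine setLIntegral_mono' (isOpen_upperHalf n).measurableSet fun p hp => ?_
    have hpos := (zpow_neg_pos_of_mem_upperHalf hp).le
    rw [weightedDensity, ← ENNReal.ofReal_mul hK, ← mul_assoc]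
    refine ENNReal.ofReal_le_ofReal (mul_le_mul_of_nonneg_right ?_ hpos)
    first | exact (hb u hu p hp).1 | exact (hb u hu p hp).2

theorem cubeSobNormSq_dyadicPiece {n m k : ℕ} {α : Fin n → ℤ} {u : ℝ × (Fin n → ℝ) → ℝ}
    (h : ContDiffOn ℝ (⊤ : ℕ∞) u (upperHalf n)) :
    cubeSobNormSq n m (dyadicPiece n k α u) =
      ∫⁻ p in dyadicBox n k α, ENNReal.ofReal ((∑ q ∈ zeroIndex n m,
        (((2 : ℝ) ^ (-(k : ℤ))) ^ (q.1 + ∑ j, q.2 j) * flatDeriv n q.1 q.2 u p) ^ 2) *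
          (2 ^ k) ^ (n + 1)) := by
  have hsum : ∀ p, ENNReal.ofReal ((∑ q ∈ zeroIndex n m,
        (((2 : ℝ) ^ (-(k : ℤ))) ^ (q.1 + ∑ j, q.2 j) * flatDeriv n q.1 q.2 u p) ^ 2) *
          (2 ^ k) ^ (n + 1)) = ENNReal.ofReal ((2 ^ k) ^ (n + 1)) * ∑ q ∈ zeroIndex n m,
          ENNReal.ofReal
            ((((2 : ℝ) ^ (-(k : ℤ))) ^ (q.1 + ∑ j, q.2 j) * flatDeriv n q.1 q.2 u p) ^ 2) := by
    intro p
    rw [mul_comm, ENNReal.ofReal_mul (by positivity),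
      ENNReal.ofReal_sum_of_nonneg fun _ _ => sq_nonneg _]
  simp only [hsum]
  rw [lintegral_const_mul' _ _ ENNReal.ofReal_ne_top, lintegral_finsetSum', Finset.mul_sum,
    cubeSobNormSq]
  · refine Finset.sum_congr rfl fun q _ => ?_
    rw [dyadicPiece_eq, flatDeriv_comp_smul_add]
    exact lintegral_dyadicBox n k α fun p => ENNReal.ofReal
      ((((2 : ℝ) ^ (-(k : ℤ))) ^ (q.1 + ∑ j, q.2 j) * flatDeriv n q.1 q.2 u p) ^ 2)
  · intro q _
    exact aemeasurable_ofReal_of_continuousOn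
      ((continuousOn_const.mul ((contDiffOn_flatDeriv h q.1 q.2).continuousOn.mono
        (dyadicBox_subset_upperHalf n k α))).pow 2) (measurableSet_dyadicBox n k α)

/-- Comparability of weighted square sums for comparable weights. -/
theorem sum_weight_mul_le {n m : ℕ} {s t : ℝ} (hs : 0 < s) (ht : 0 < t) (hst : s ≤ 2 * t)
    (hts : t ≤ 2 * s) (x : ℕ × (Fin n → ℕ) → ℝ) :
    (∑ q ∈ zeroIndex n m, (s ^ (q.1 + ∑ j, q.2 j) * x q) ^ 2) * s⁻¹ ^ (n + 1) ≤
      2 ^ (2 * m + (n + 1)) *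
        ((∑ q ∈ zeroIndex n m, (t ^ (q.1 + ∑ j, q.2 j) * x q) ^ 2) * t⁻¹ ^ (n + 1)) := by
  have hinv : s⁻¹ ≤ 2 * t⁻¹ := by
    rw [← div_eq_mul_inv, inv_eq_one_div, div_le_div_iff₀ hs ht]
    linarith
  have hx : ∑ q ∈ zeroIndex n m, (s ^ (q.1 + ∑ j, q.2 j) * x q) ^ 2 ≤
      2 ^ (2 * m) * ∑ q ∈ zeroIndex n m, (t ^ (q.1 + ∑ j, q.2 j) * x q) ^ 2 := by
    rw [Finset.mul_sum]
    refine Finset.sum_le_sum fun q hq => ?_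
    have hd : s ^ (q.1 + ∑ j, q.2 j) ≤ 2 ^ m * t ^ (q.1 + ∑ j, q.2 j) :=
      calc s ^ (q.1 + ∑ j, q.2 j) ≤ (2 * t) ^ (q.1 + ∑ j, q.2 j) := by gcongr
        _ = 2 ^ (q.1 + ∑ j, q.2 j) * t ^ (q.1 + ∑ j, q.2 j) := mul_pow _ _ _
        _ ≤ _ := by
          gcongr
          · norm_num
          · exact mem_zeroIndex.1 hq
    calc (s ^ (q.1 + ∑ j, q.2 j) * x q) ^ 2
        = (s ^ (q.1 + ∑ j, q.2 j)) ^ 2 * x q ^ 2 := mul_pow _ _ _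
      _ ≤ (2 ^ m * t ^ (q.1 + ∑ j, q.2 j)) ^ 2 * x q ^ 2 := by gcongr
      _ = _ := by ring
  calc _ ≤ (2 ^ (2 * m) * ∑ q ∈ zeroIndex n m, (t ^ (q.1 + ∑ j, q.2 j) * x q) ^ 2) *
        (2 * t⁻¹) ^ (n + 1) := by
        gcongr
    _ = _ := by ring

theorem cubeSobNormSq_dyadicPiece_bound {n m k : ℕ} {α : Fin n → ℤ}
    {u : ℝ × (Fin n → ℝ) → ℝ} (h : ContDiffOn ℝ (⊤ : ℕ∞) u (upperHalf n)) :
    cubeSobNormSq n m (dyadicPiece n k α u) ≤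
        ENNReal.ofReal (2 ^ (2 * m + (n + 1))) *
          ∫⁻ p in dyadicBox n k α, weightedDensity n m u p ∧
      ∫⁻ p in dyadicBox n k α, weightedDensity n m u p ≤
        ENNReal.ofReal (2 ^ (2 * m + (n + 1))) *
          cubeSobNormSq n m (dyadicPiece n k α u) := by
  have h2 : (0 : ℝ) < 2 ^ k := by positivity
  have hc : (0 : ℝ) < 2 ^ (-(k : ℤ)) := by positivity
  have hcinv : ((2 : ℝ) ^ (-(k : ℤ)))⁻¹ = 2 ^ k := by simp
  have hz : ∀ p : ℝ × (Fin n → ℝ), p.1 ^ (-(n + 1 : ℤ)) = p.1⁻¹ ^ (n + 1) := fun p => by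
    rw [zpow_neg, inv_pow]
    norm_cast
  have hcp : ∀ p ∈ dyadicBox n k α, 0 < p.1 ∧ (2 : ℝ) ^ (-(k : ℤ)) ≤ 2 * p.1 ∧
      p.1 ≤ 2 * (2 : ℝ) ^ (-(k : ℤ)) := by
    intro p hp
    obtain ⟨h1, h3⟩ := fst_bounds_of_mem_dyadicBox hp
    refine ⟨mem_upperHalf.1 (dyadicBox_subset_upperHalf n k α hp), ?_, ?_⟩
    · rw [zpow_neg, zpow_natCast, inv_le_iff_one_le_mul₀ h2]
      linarith
    · rw [zpow_neg, zpow_natCast, ← div_eq_mul_inv, le_div_iff₀ h2]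
      linarith
  rw [cubeSobNormSq_dyadicPiece h, ← lintegral_const_mul' _ _ ENNReal.ofReal_ne_top,
    ← lintegral_const_mul' _ _ ENNReal.ofReal_ne_top]
  constructor <;>
  · refine setLIntegral_mono' (measurableSet_dyadicBox n k α) fun p hp => ?_
    obtain ⟨h0, h1, h3⟩ := hcp p hp
    rw [weightedDensity, ← ENNReal.ofReal_mul (by positivity), hz, ← hcinv]
    refine ENNReal.ofReal_le_ofReal ?_
    first
    | exact sum_weight_mul_le hc h0 h1 h3 fun q => flatDeriv n q.1 q.2 u p
    | exact sum_weight_mul_le h0 hc h3 h1 fun q => flatDeriv n q.1 q.2 u p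

/-- Every point lies in at most `2 * 2 ^ n` dyadic boxes. -/
theorem exists_finset_mem_dyadicBox (n : ℕ) (p : ℝ × (Fin n → ℝ)) :
    ∃ s : Finset (ℕ × (Fin n → ℤ)), s.card ≤ 2 * 2 ^ n ∧
      ∀ q : ℕ × (Fin n → ℤ), p ∈ dyadicBox n q.1 q.2 → q ∈ s := by
  classical
  by_cases hne : ∃ k : ℕ, |2 ^ k * p.1 - 1| ≤ 1 / 2
  swap
  · exact ⟨∅, by simp, fun q hq => (hne ⟨q.1, hq.1⟩).elim⟩
  let a := Nat.find hne
  let t : ℕ → Finset (Fin n → ℤ) := fun k =>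
    Fintype.piFinset fun j => {⌊2 ^ k * p.2 j⌋, ⌊2 ^ k * p.2 j⌋ + 1}
  refine ⟨({a, a + 1} : Finset ℕ).biUnion fun k => (t k).image (Prod.mk k), ?_, ?_⟩
  · refine (Finset.card_biUnion_le_card_mul _ _ (2 ^ n) fun k _ => ?_).trans
      (Nat.mul_le_mul_right _ Finset.card_le_two)
    refine Finset.card_image_le.trans ?_
    rw [Fintype.card_piFinset]
    refine (Finset.prod_le_pow_card _ _ 2 fun j _ => Finset.card_le_two).trans ?_
    simp
  · rintro ⟨k, α⟩ ⟨hk, hα⟩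
    simp only at hk hα
    refine Finset.mem_biUnion.2 ⟨k, ?_, Finset.mem_image.2 ⟨α, Fintype.mem_piFinset.2 ?_, rfl⟩⟩
    · obtain ⟨d, hd⟩ := Nat.exists_eq_add_of_le (Nat.find_min' hne hk)
      change k = a + d at hd
      have ha : |2 ^ a * p.1 - 1| ≤ 1 / 2 := Nat.find_spec hne
      have hd2 : d < 2 := by
        by_contra! h
        have h4 : (4 : ℝ) ≤ 2 ^ d := by
          calc (4 : ℝ) = 2 ^ 2 := by norm_num
            _ ≤ 2 ^ d := pow_le_pow_right₀ (by norm_num) h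
        rw [hd, pow_add] at hk
        have h1 := abs_le.1 ha
        have h2 := abs_le.1 hk
        nlinarith
      rw [Finset.mem_insert, Finset.mem_singleton]
      omega
    · intro j
      have h1 := abs_le.1 (hα j)
      have h2 := Int.floor_le (2 ^ k * p.2 j)
      have h3 := Int.lt_floor_add_one (2 ^ k * p.2 j)
      have h4 : ⌊2 ^ k * p.2 j⌋ - 1 < α j := by
        have : ((⌊2 ^ k * p.2 j⌋ - 1 : ℤ) : ℝ) < α j := by push_cast; linarith
        exact_mod_cast this
      have h5 : α j < ⌊2 ^ k * p.2 j⌋ + 2 := by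
        have : (α j : ℝ) < ((⌊2 ^ k * p.2 j⌋ + 2 : ℤ) : ℝ) := by push_cast; linarith
        exact_mod_cast this
      rw [Finset.mem_insert, Finset.mem_singleton]
      omega

theorem tsum_lintegral_dyadicBox_le {n : ℕ} {g : ℝ × (Fin n → ℝ) → ℝ≥0∞}
    (hg : AEMeasurable g (volume.restrict (upperHalf n))) :
    ∑' q : ℕ × (Fin n → ℤ), ∫⁻ p in dyadicBox n q.1 q.2, g p ≤
      ENNReal.ofReal (2 * 2 ^ n) * ∫⁻ p in upperHalf n, g p := by
  have hind : ∀ q : ℕ × (Fin n → ℤ), ∫⁻ p in dyadicBox n q.1 q.2, g p =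
      ∫⁻ p in upperHalf n, (dyadicBox n q.1 q.2).indicator g p := fun q => by
    rw [setLIntegral_indicator (measurableSet_dyadicBox _ _ _),
      Set.inter_eq_left.2 (dyadicBox_subset_upperHalf _ _ _)]
  simp only [hind]
  rw [← lintegral_tsum fun q => hg.indicator (measurableSet_dyadicBox _ _ _),
    ← lintegral_const_mul' _ _ ENNReal.ofReal_ne_top]
  refine lintegral_mono fun p => ?_
  obtain ⟨s, hs, hmem⟩ := exists_finset_mem_dyadicBox n p
  rw [tsum_eq_sum (s := s) fun q hq => Set.indicator_of_notMem (fun h => hq (hmem q h)) _]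
  calc ∑ q ∈ s, (dyadicBox n q.1 q.2).indicator g p ≤ ∑ _q ∈ s, g p :=
        Finset.sum_le_sum fun q _ => Set.indicator_le_self _ _ _
    _ = (s.card : ℝ≥0∞) * g p := by simp
    _ ≤ _ := by
      gcongr
      rw [← ENNReal.ofReal_natCast]
      exact ENNReal.ofReal_le_ofReal (by exact_mod_cast hs)

/-- The dyadic boxes with `|α|_∞ ≤ 2 ^ k` cover `(0,1] × {|x|_∞ ≤ 1}`. -/
theorem exists_mem_dyadicBox {n : ℕ} {p : ℝ × (Fin n → ℝ)} (h0 : 0 < p.1) (h1 : p.1 ≤ 1)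
    (hx : ‖p.2‖ ≤ 1) :
    ∃ q : ℕ × (Fin n → ℤ), (∀ j, |q.2 j| ≤ 2 ^ q.1) ∧ p ∈ dyadicBox n q.1 q.2 := by
  obtain ⟨k, hk1, hk2⟩ := exists_nat_pow_near_of_lt_one h0 h1 (one_half_pos (α := ℝ)) one_half_lt_one
  have h2 : (0 : ℝ) < 2 ^ k := by positivity
  refine ⟨(k, fun j => round (2 ^ k * p.2 j)), fun j => ?_, ?_, fun j => abs_sub_round _⟩
  · have hb : |2 ^ k * p.2 j| ≤ 2 ^ k := by
      rw [abs_mul, abs_of_pos h2]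
      exact mul_le_of_le_one_right h2.le ((norm_le_pi_norm p.2 j).trans hx)
    have hr := abs_le.1 (abs_sub_round (2 ^ k * p.2 j))
    have hb' := abs_le.1 hb
    have e1 : round (2 ^ k * p.2 j) < (2 ^ k + 1 : ℤ) := by
      have : (round (2 ^ k * p.2 j) : ℝ) < ((2 ^ k + 1 : ℤ) : ℝ) := by push_cast; linarith
      exact_mod_cast this
    have e2 : (-(2 ^ k) - 1 : ℤ) < round (2 ^ k * p.2 j) := by
      have : ((-(2 ^ k) - 1 : ℤ) : ℝ) < (round (2 ^ k * p.2 j) : ℝ) := by push_cast; linarith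
      exact_mod_cast this
    exact abs_le.2 ⟨by simp only; omega, by simp only; omega⟩
  · rw [one_div, inv_pow] at hk1 hk2
    rw [inv_lt_iff_one_lt_mul₀ (by positivity), pow_succ] at hk1
    have hk2' := mul_le_mul_of_nonneg_left hk2 h2.le
    rw [mul_inv_cancel₀ h2.ne'] at hk2'
    exact abs_le.2 ⟨by simp only; linarith, by simp only; linarith⟩

theorem weightedDensity_eq_zero {n m : ℕ} {u : ℝ × (Fin n → ℝ) → ℝ}
    (hu : Function.support u ⊆ {p : ℝ × (Fin n → ℝ) | p.1 ≤ 1 ∧ ‖p.2‖ ≤ 1})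
    {p : ℝ × (Fin n → ℝ)} (hp : ¬ (p.1 ≤ 1 ∧ ‖p.2‖ ≤ 1)) : weightedDensity n m u p = 0 := by
  have hV : IsOpen {p : ℝ × (Fin n → ℝ) | p.1 ≤ 1 ∧ ‖p.2‖ ≤ 1}ᶜ :=
    ((isClosed_le continuous_fst continuous_const).inter
      (isClosed_le continuous_snd.norm continuous_const)).isOpen_compl
  have h0 : Set.EqOn u 0 {p : ℝ × (Fin n → ℝ) | p.1 ≤ 1 ∧ ‖p.2‖ ≤ 1}ᶜ := fun q hq => by
    by_contra h
    exact hq (hu h)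
  have hd : ∀ q : ℕ × (Fin n → ℕ), flatDeriv n q.1 q.2 u p = 0 := fun q =>
    flatDeriv_eqOn_zero hV h0 q.1 q.2 hp
  simp [weightedDensity, weightedDeriv, hd]

theorem lintegral_weightedDensity_le {n m : ℕ} {u : ℝ × (Fin n → ℝ) → ℝ}
    (hu : Function.support u ⊆ {p : ℝ × (Fin n → ℝ) | p.1 ≤ 1 ∧ ‖p.2‖ ≤ 1}) :
    ∫⁻ p in upperHalf n, weightedDensity n m u p ≤
      ∑' q : ℕ × (Fin n → ℤ), if ∀ j, |q.2 j| ≤ 2 ^ q.1 then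
        ∫⁻ p in dyadicBox n q.1 q.2, weightedDensity n m u p else 0 := by
  let B : ℕ × (Fin n → ℤ) → Set (ℝ × (Fin n → ℝ)) := fun q =>
    if ∀ j, |q.2 j| ≤ 2 ^ q.1 then dyadicBox n q.1 q.2 else ∅
  have hB : ∀ q, MeasurableSet (B q) := fun q => by
    by_cases h : ∀ j, |q.2 j| ≤ 2 ^ q.1
    · simp only [B, if_pos h]
      exact measurableSet_dyadicBox _ _ _
    · simp only [B, if_neg h]
      exact MeasurableSet.empty
  calc ∫⁻ p in upperHalf n, weightedDensity n m u p
      ≤ ∫⁻ p in upperHalf n, (⋃ q, B q).indicator (weightedDensity n m u) p := by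
        refine setLIntegral_mono' (isOpen_upperHalf n).measurableSet fun p hp => ?_
        by_cases h : p.1 ≤ 1 ∧ ‖p.2‖ ≤ 1
        · obtain ⟨q, hq, hpq⟩ := exists_mem_dyadicBox (mem_upperHalf.1 hp) h.1 h.2
          rw [Set.indicator_of_mem]
          exact Set.mem_iUnion.2 ⟨q, by simpa only [B, if_pos hq] using hpq⟩
        · simp [weightedDensity_eq_zero hu h]
    _ ≤ ∫⁻ p, (⋃ q, B q).indicator (weightedDensity n m u) p :=
        setLIntegral_le_lintegral _ _
    _ = ∫⁻ p in ⋃ q, B q, weightedDensity n m u p :=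
        lintegral_indicator (MeasurableSet.iUnion hB) _
    _ ≤ ∑' q, ∫⁻ p in B q, weightedDensity n m u p := lintegral_iUnion_le _ _
    _ = _ := by
        refine tsum_congr fun q => ?_
        by_cases h : ∀ j, |q.2 j| ≤ 2 ^ q.1
        · simp only [B, if_pos h]
        · simp only [B, if_neg h, Measure.restrict_empty, lintegral_zero_measure]

theorem dyadicNormSq_eq_tsum_prod (n m : ℕ) (u : ℝ × (Fin n → ℝ) → ℝ) :
    dyadicNormSq n m u = ∑' q : ℕ × (Fin n → ℤ), if ∀ j, |q.2 j| ≤ 2 ^ q.1 then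
      cubeSobNormSq n m (dyadicPiece n q.1 q.2 u) else 0 :=
  (ENNReal.tsum_prod' (f := fun q : ℕ × (Fin n → ℤ) => if ∀ j, |q.2 j| ≤ 2 ^ q.1 then
      cubeSobNormSq n m (dyadicPiece n q.1 q.2 u) else 0)).symm

/-- There is a constant `C > 1` such that for every smooth `u` on
`(0,∞) × ℝⁿ` supported in `{τ ≤ 1, |x| ≤ 1}`, the squared 0-Sobolev norm of order `m`
is comparable (with constant `C`) to the square-summed standard Sobolev norms of the
dyadic rescalings `u_{k,α}`. -/
theorem stmt_5 (n m : ℕ) :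
    ∃ C : ℝ, 1 < C ∧
      ∀ u : ℝ × (Fin n → ℝ) → ℝ,
        ContDiffOn ℝ (⊤ : ℕ∞) u (Set.Ioi (0 : ℝ) ×ˢ (Set.univ : Set (Fin n → ℝ))) →
        Function.support u ⊆ {p : ℝ × (Fin n → ℝ) | p.1 ≤ 1 ∧ ‖p.2‖ ≤ 1} →
        (ENNReal.ofReal C)⁻¹ * zeroSobNormSq n m u ≤ dyadicNormSq n m u ∧
          dyadicNormSq n m u ≤ ENNReal.ofReal C * zeroSobNormSq n m u := by
  obtain ⟨K, hK, hb⟩ := exists_zeroSobNormSq_bound n m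
  set M : ℝ := 2 ^ (2 * m + (n + 1))
  have hM0 : 0 ≤ M := by positivity
  set N : ℝ := 2 * 2 ^ n
  have hN0 : 0 ≤ N := by positivity
  have hC : 1 < K * M + M * N * K + 2 := by
    have : 0 ≤ K * M + M * N * K := by positivity
    linarith
  refine ⟨K * M + M * N * K + 2, hC, fun u hu hsupp => ?_⟩
  obtain ⟨hle, hge⟩ := hb u hu
  constructor
  · rw [ENNReal.inv_mul_le_iff (by simp only [ne_eq, ENNReal.ofReal_eq_zero]; linarith)
      ENNReal.ofReal_ne_top]
    calc zeroSobNormSq n m u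
        ≤ ENNReal.ofReal K * ∫⁻ p in upperHalf n, weightedDensity n m u p := hle
      _ ≤ ENNReal.ofReal K * (ENNReal.ofReal M * dyadicNormSq n m u) := by
        gcongr
        refine (lintegral_weightedDensity_le hsupp).trans ?_
        rw [dyadicNormSq_eq_tsum_prod, ← ENNReal.tsum_mul_left]
        refine ENNReal.tsum_le_tsum fun q => ?_
        split_ifs
        · exact (cubeSobNormSq_dyadicPiece_bound hu).2
        · exact zero_le
      _ = ENNReal.ofReal (K * M) * dyadicNormSq n m u := by
        rw [ENNReal.ofReal_mul hK, mul_assoc]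
      _ ≤ _ := by
        gcongr
        have : 0 ≤ M * N * K := by positivity
        linarith
  · calc dyadicNormSq n m u
        ≤ ∑' q : ℕ × (Fin n → ℤ), ENNReal.ofReal M *
            ∫⁻ p in dyadicBox n q.1 q.2, weightedDensity n m u p := by
          rw [dyadicNormSq_eq_tsum_prod]
          refine ENNReal.tsum_le_tsum fun q => ?_
          split_ifs
          · exact (cubeSobNormSq_dyadicPiece_bound hu).1
          · exact zero_le
      _ ≤ ENNReal.ofReal M * (ENNReal.ofReal N * (ENNReal.ofReal K * zeroSobNormSq n m u)) := by
        rw [ENNReal.tsum_mul_left]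
        gcongr
        refine (tsum_lintegral_dyadicBox_le (aemeasurable_weightedDensity hu)).trans ?_
        gcongr
      _ = ENNReal.ofReal (M * N * K) * zeroSobNormSq n m u := by
        rw [ENNReal.ofReal_mul (mul_nonneg hM0 hN0), ENNReal.ofReal_mul hM0]
        ring
      _ ≤ _ := by
        gcongr
        have : 0 ≤ K * M := by positivity
        linarith
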